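/- Let F be a 2-cocycle of a finite-dimensional Hopf algebra H with Drinfeld element u, and set Q = u·S(u⁻¹). Then for every n ≥ 1: F_n · Δⁿ(Q) = Q^{⊗n} · (S²)^{⊗n}(F_n). -/

import Mathlib

/-!
STATEMENT 10 (Lemma `lem:trick-3`(v), eq. (f-DQ-Q-Sf)):
For a 2-cocycle F of a finite-dimensional Hopf algebra H with Drinfeld element
u = f⁽¹⁾S(f⁽²⁾) and Q = u·S(u⁻¹), for every n ≥ 1:
  F_n · Δⁿ(Q) = Q^{⊗n} · (S²)^{⊗n}(F_n).
(Here `comulIter (n-1) = Δⁿ`, `Fseq F (n-1) = F_n`, `u⁻¹ = Ring.inverse u`.)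
-/

open TensorProduct

structure AlgBundle (k : Type) [CommRing k] where
  carrier : Type
  ring : Ring carrier
  alg : @Algebra k carrier _ ring.toSemiring

section
variable (k H : Type) [Field k] [Ring H] [HopfAlgebra k H]

noncomputable def tpowB : ℕ → AlgBundle k
  | 0 => ⟨H, inferInstance, inferInstance⟩
  | n + 1 =>
      letI := (tpowB n).ring
      letI := (tpowB n).alg
      ⟨TensorProduct k H (tpowB n).carrier, inferInstance, inferInstance⟩

/-- `Tpow k H n` is the (n+1)-fold tensor power `H ⊗ (H ⊗ (⋯ ⊗ H))`. -/
noncomputable def Tpow (n : ℕ) : Type := (tpowB k H n).carrier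

noncomputable instance instTpowRing (n : ℕ) : Ring (Tpow k H n) := (tpowB k H n).ring
noncomputable instance instTpowAlgebra (n : ℕ) : Algebra k (Tpow k H n) := (tpowB k H n).alg

/-- The iterated comultiplication `Δ^{n+1} : H → H^{⊗(n+1)}`. -/
noncomputable def comulIter : ∀ n : ℕ, H →ₗ[k] Tpow k H n
  | 0 => LinearMap.id
  | n + 1 =>
      show H →ₗ[k] TensorProduct k H (Tpow k H n) from
        (TensorProduct.map LinearMap.id (comulIter n)) ∘ₗ Coalgebra.comul

/-- The higher twists of `F`:  `Fseq F n = F_{n+1}`. -/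
noncomputable def Fseq (F : H ⊗[k] H) : ∀ n : ℕ, Tpow k H n
  | 0 => 1
  | n + 1 =>
      show TensorProduct k H (Tpow k H n) from
        ((1 : H) ⊗ₜ[k] Fseq F n) * (TensorProduct.map LinearMap.id (comulIter k H n) F)

/-- Cast between tensor powers of equal length. -/
noncomputable def tcast {a b : ℕ} (h : a = b) : Tpow k H a ≃ₗ[k] Tpow k H b :=
  h ▸ LinearEquiv.refl k (Tpow k H a)

/-- The canonical identification `H^{⊗(a+1)} ⊗ H^{⊗(b+1)} ≅ H^{⊗(a+b+2)}`. -/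
noncomputable def concEquiv : ∀ a b : ℕ, (Tpow k H a ⊗[k] Tpow k H b) ≃ₗ[k] Tpow k H (a + 1 + b)
  | 0, b =>
      (show (Tpow k H 0 ⊗[k] Tpow k H b) ≃ₗ[k] Tpow k H (b + 1) from
        LinearEquiv.refl k (Tpow k H 0 ⊗[k] Tpow k H b)).trans (tcast k H (by omega))
  | a + 1, b =>
      (show (Tpow k H (a+1) ⊗[k] Tpow k H b) ≃ₗ[k] H ⊗[k] (Tpow k H a ⊗[k] Tpow k H b) from
        TensorProduct.assoc k H (Tpow k H a) (Tpow k H b)).trans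
      ((TensorProduct.congr (LinearEquiv.refl k H) (concEquiv a b)).trans
        ((show (TensorProduct k H (Tpow k H (a + 1 + b))) ≃ₗ[k] Tpow k H (a + 1 + b + 1) from
            LinearEquiv.refl k _).trans (tcast k H (by omega))))


/-- The nested pure tensor `f 0 ⊗ f 1 ⊗ ⋯ ⊗ f n` of a tuple. -/
noncomputable def nest : ∀ n : ℕ, (Fin (n + 1) → H) → Tpow k H n
  | 0, f => f 0
  | n + 1, f =>
      show TensorProduct k H (Tpow k H n) from f 0 ⊗ₜ[k] nest n (fun i => f i.succ)

/-- `S ⊗ S ⊗ ⋯ ⊗ S` on `H^{⊗(n+1)}`. -/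
noncomputable def tmapPow (S : H →ₗ[k] H) : ∀ n : ℕ, Tpow k H n →ₗ[k] Tpow k H n
  | 0 => S
  | n + 1 =>
      show TensorProduct k H (Tpow k H n) →ₗ[k] TensorProduct k H (Tpow k H n) from
        TensorProduct.map S (tmapPow S n)

end


section Aux
open Coalgebra HopfAlgebra WithConv

variable {k H : Type} [Field k] [Ring H] [HopfAlgebra k H]

lemma aux_map_comul_mul (T T' : H ⊗[k] H) :
    TensorProduct.map LinearMap.id (comul (R := k) (A := H)) (T * T') =
    TensorProduct.map LinearMap.id (comul (R := k) (A := H)) T *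
      TensorProduct.map LinearMap.id (comul (R := k) (A := H)) T' :=
  map_mul (Algebra.TensorProduct.map (AlgHom.id k H) (Bialgebra.comulAlgHom k H)) T T'

/-- The map `x ↦ S(x₂) ⊗ S(x₁)`. -/
noncomputable def auxG : H →ₗ[k] H ⊗[k] H :=
  TensorProduct.map (antipode k) (antipode k) ∘ₗ
    (TensorProduct.comm k H H).toLinearMap ∘ₗ comul

/-- The map `a ⊗ b ⊗ c ↦ S(b)c ⊗ S(a)d`. -/
noncomputable def auxTheta (d : H) : (H ⊗[k] H) ⊗[k] H →ₗ[k] H ⊗[k] H :=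
  TensorProduct.map (LinearMap.mul' k H ∘ₗ TensorProduct.map (antipode k) LinearMap.id)
    (LinearMap.mulRight k d ∘ₗ antipode k) ∘ₗ
    (TensorProduct.comm k H (H ⊗[k] H)).toLinearMap ∘ₗ
    (TensorProduct.assoc k H H H).toLinearMap

lemma aux_S_id (b : H) : LinearMap.mul' k H
    (TensorProduct.map (antipode k) LinearMap.id (comul (R := k) b)) =
    algebraMap k H (counit b) := mul_antipode_rTensor_comul_apply b

lemma aux_id_S (b : H) : LinearMap.mul' k H
    (TensorProduct.map LinearMap.id (antipode k) (comul (R := k) b)) =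
    algebraMap k H (counit b) := mul_antipode_lTensor_comul_apply b

lemma aux1 (d : H) (T : H ⊗[k] H) :
    TensorProduct.lift ((LinearMap.mul k (H ⊗[k] H)) ∘ₗ auxG)
      (TensorProduct.assoc k H H H (T ⊗ₜ d)) =
    auxTheta d (TensorProduct.map comul LinearMap.id T) := by
  induction T with
  | zero => simp
  | add a b ha hb => simp only [TensorProduct.add_tmul, map_add, ha, hb]
  | tmul a b =>
    simp only [TensorProduct.assoc_tmul, TensorProduct.lift.tmul, TensorProduct.map_tmul,
      LinearMap.comp_apply, auxG, LinearMap.mul_apply', LinearMap.id_apply]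
    generalize comul (R := k) a = W
    induction W with
    | zero => simp
    | add a b ha hb => simp only [TensorProduct.add_tmul, map_add, ← ha, ← hb, add_mul]
    | tmul x y => simp [auxTheta]

lemma aux2 (x d : H) :
    TensorProduct.lift ((LinearMap.mul k (H ⊗[k] H)) ∘ₗ auxG)
      (TensorProduct.assoc k H H H (comul (R := k) x ⊗ₜ d)) =
    (1 : H) ⊗ₜ[k] (antipode k x * d) := by
  rw [aux1]
  have h := Coalgebra.coassoc_apply (R := k) x
  have h2 : TensorProduct.map (comul (R := k)) LinearMap.id (comul (R := k) x) =
    (TensorProduct.assoc k H H H).symm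
      (TensorProduct.map LinearMap.id (comul (R := k)) (comul (R := k) x)) := by
    rw [LinearEquiv.eq_symm_apply]; exact h
  rw [h2]
  have h3 : ∀ T : H ⊗[k] H, auxTheta d ((TensorProduct.assoc k H H H).symm
      (TensorProduct.map LinearMap.id (comul (R := k)) T)) =
      (1 : H) ⊗ₜ[k] (antipode k (TensorProduct.rid k H
        (TensorProduct.map LinearMap.id (counit (R := k)) T)) * d) := by
    intro T
    induction T with
    | zero => simp
    | add a b ha hb => simp only [map_add, ha, hb, add_mul, TensorProduct.tmul_add]
    | tmul a b =>
      simp only [auxTheta, TensorProduct.map_tmul, LinearMap.comp_apply,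
        LinearEquiv.coe_coe, LinearEquiv.apply_symm_apply, TensorProduct.comm_tmul, aux_S_id,
        LinearMap.id_apply, TensorProduct.rid_tmul, LinearMap.mulRight_apply]
      rw [Algebra.algebraMap_eq_smul_one, TensorProduct.smul_tmul, map_smul, smul_mul_assoc]
  rw [h3]
  congr 2
  have := Coalgebra.lTensor_counit_comul (R := k) x
  have h4 : TensorProduct.map LinearMap.id (counit (R := k)) (comul (R := k) x) = x ⊗ₜ[k] 1 := this
  rw [h4]; simp

lemma aux_left_inv : toConv (auxG (k := k) (H := H)) * toConv (comul (R := k)) = 1 := by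
  ext h
  rw [LinearMap.convMul_apply, LinearMap.convOne_apply]
  have e1 : ∀ T : H ⊗[k] H, LinearMap.mul' k (H ⊗[k] H) (TensorProduct.map auxG comul T) =
      TensorProduct.lift ((LinearMap.mul k (H ⊗[k] H)) ∘ₗ auxG)
        (TensorProduct.map LinearMap.id comul T) := by
    intro T
    induction T with
    | zero => simp
    | add a b ha hb => simp only [map_add, ha, hb]
    | tmul a b => simp
  have e2 : ∀ T : H ⊗[k] H, TensorProduct.lift ((LinearMap.mul k (H ⊗[k] H)) ∘ₗ auxG)
        (TensorProduct.assoc k H H H (TensorProduct.map comul LinearMap.id T)) =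
        (1 : H) ⊗ₜ[k] (LinearMap.mul' k H (TensorProduct.map (antipode k) LinearMap.id T)) := by
    intro T
    induction T with
    | zero => simp
    | add a b ha hb => simp only [map_add, ha, hb, TensorProduct.tmul_add]
    | tmul a b =>
      rw [TensorProduct.map_tmul, LinearMap.id_apply, aux2]; simp
  have e3 : TensorProduct.map LinearMap.id (comul (R := k)) (comul (R := k) h) =
    TensorProduct.assoc k H H H
      (TensorProduct.map (comul (R := k)) LinearMap.id (comul (R := k) h)) :=
    (Coalgebra.coassoc_apply (R := k) h).symm
  change LinearMap.mul' k (H ⊗[k] H) (TensorProduct.map auxG comul (comul h)) = _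
  rw [e1, e3, e2, aux_S_id, Algebra.algebraMap_eq_smul_one, TensorProduct.tmul_smul,
    Algebra.algebraMap_eq_smul_one]
  rfl

lemma aux_comul_antipode (h : H) : comul (R := k) (antipode k h) =
    TensorProduct.map (antipode k) (antipode k) (TensorProduct.comm k H H (comul (R := k) h)) := by
  have := left_inv_eq_right_inv (aux_left_inv (k := k) (H := H)) LinearMap.comul_right_inv
  exact (LinearMap.congr_fun (congrArg WithConv.ofConv this) h).symm

lemma aux_inv (S : H →ₗ[k] H) (hS : S = antipode k) (F F' : H ⊗[k] H)
    (hinv₁ : F * F' = 1) (hinv₂ : F' * F = 1)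
    (hcu₁ : (TensorProduct.lid k H)
      ((TensorProduct.map (Coalgebra.counit (R := k)) LinearMap.id) F) = 1)
    (hcu₂ : (TensorProduct.rid k H)
      ((TensorProduct.map LinearMap.id (Coalgebra.counit (R := k))) F) = 1)
    (hcoc : ((1 : H) ⊗ₜ[k] F) *
        (TensorProduct.map LinearMap.id (Coalgebra.comul (R := k)) F) =
      (TensorProduct.assoc k H H H)
        ((F ⊗ₜ[k] (1 : H)) *
          (TensorProduct.map (Coalgebra.comul (R := k)) LinearMap.id F))) :
    LinearMap.mul' k H ((TensorProduct.map LinearMap.id S) F) *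
      LinearMap.mul' k H ((TensorProduct.map S LinearMap.id) F') = 1 := by
  subst hS
  have hcu' : (TensorProduct.lid k H)
      ((TensorProduct.map (Coalgebra.counit (R := k)) LinearMap.id) F') = 1 := by
    let φ : H ⊗[k] H →ₐ[k] H := (Algebra.TensorProduct.lid k H).toAlgHom.comp
      (Algebra.TensorProduct.map (Bialgebra.counitAlgHom k H) (AlgHom.id k H))
    have h1 : φ F = 1 := hcu₁
    have h2 : φ (F * F') = 1 := by rw [hinv₁, map_one]
    rw [map_mul, h1, one_mul] at h2
    exact h2
  -- algebra homs
  let A : (H ⊗[k] H) ⊗[k] H →ₐ[k] H ⊗[k] (H ⊗[k] H) :=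
    (Algebra.TensorProduct.assoc k k k H H H).toAlgHom
  let D1 : H ⊗[k] H →ₐ[k] (H ⊗[k] H) ⊗[k] H :=
    Algebra.TensorProduct.map (Bialgebra.comulAlgHom k H) (AlgHom.id k H)
  have key : TensorProduct.map LinearMap.id (comul (R := k)) F *
      TensorProduct.assoc k H H H (TensorProduct.map (comul (R := k)) LinearMap.id F') =
      ((1 : H) ⊗ₜ[k] F') * TensorProduct.assoc k H H H (F ⊗ₜ[k] (1 : H)) := by
    have hc : ((1 : H) ⊗ₜ[k] F) * (TensorProduct.map LinearMap.id (Coalgebra.comul (R := k)) F) =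
      A (F ⊗ₜ[k] (1 : H)) * A (D1 F) := by rw [← map_mul]; exact hcoc
    change _ * A (D1 F') = _ * A (F ⊗ₜ[k] (1 : H))
    have h1 : A (D1 F) * A (D1 F') = 1 := by rw [← map_mul, ← map_mul, hinv₁, map_one, map_one]
    have h2 : ((1 : H) ⊗ₜ[k] F') * ((1 : H) ⊗ₜ[k] F) = 1 := by
      rw [Algebra.TensorProduct.tmul_mul_tmul, hinv₂, one_mul]; rfl
    calc _ = (((1 : H) ⊗ₜ[k] F') * ((1 : H) ⊗ₜ[k] F)) *
        (TensorProduct.map LinearMap.id (Coalgebra.comul (R := k)) F * A (D1 F')) := by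
          rw [h2, one_mul]
      _ = ((1 : H) ⊗ₜ[k] F') * (((1 : H) ⊗ₜ[k] F) *
        TensorProduct.map LinearMap.id (Coalgebra.comul (R := k)) F) * A (D1 F') := by
          simp only [mul_assoc]
      _ = _ := by rw [hc, mul_assoc, mul_assoc, h1, mul_one]
  let m : H ⊗[k] (H ⊗[k] H) →ₗ[k] H := LinearMap.mul' k H ∘ₗ
    TensorProduct.map LinearMap.id
      (LinearMap.mul' k H ∘ₗ TensorProduct.map (antipode k) LinearMap.id)
  have hm : ∀ a b c : H, m (a ⊗ₜ (b ⊗ₜ c)) = a * (antipode k b * c) := fun a b c => by simp [m]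
  have e1 : ∀ X Y : H ⊗[k] H, m (((1 : H) ⊗ₜ[k] Y) * TensorProduct.assoc k H H H (X ⊗ₜ[k] (1 : H)))
      = LinearMap.mul' k H ((TensorProduct.map LinearMap.id (antipode k)) X) *
      LinearMap.mul' k H ((TensorProduct.map (antipode k) LinearMap.id) Y) := by
    intro X Y
    induction X with
    | zero => simp
    | add a b ha hb => simp only [TensorProduct.add_tmul, map_add, mul_add, add_mul, ha, hb]
    | tmul a b =>
      induction Y with
      | zero => simp
      | add a b ha hb => simp only [TensorProduct.tmul_add, map_add, mul_add, add_mul, ha, hb]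
      | tmul c d => simp [hm, antipode_mul_antidistrib, mul_assoc]
  have e2 : ∀ X Y : H ⊗[k] H, m (TensorProduct.map LinearMap.id (comul (R := k)) X *
      TensorProduct.assoc k H H H (TensorProduct.map (comul (R := k)) LinearMap.id Y)) =
      (TensorProduct.rid k H) ((TensorProduct.map LinearMap.id (Coalgebra.counit (R := k))) X) *
      (TensorProduct.lid k H)
        ((TensorProduct.map (Coalgebra.counit (R := k)) LinearMap.id) Y) := by
    intro X Y
    induction X with
    | zero => simp
    | add a b ha hb => simp only [map_add, add_mul, ha, hb]
    | tmul x y =>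
      induction Y with
      | zero => simp
      | add a b ha hb => simp only [map_add, mul_add, ha, hb]
      | tmul z w =>
        have g : ∀ T U : H ⊗[k] H, m ((x ⊗ₜ T) * TensorProduct.assoc k H H H (U ⊗ₜ w)) =
          x * (LinearMap.mul' k H ((TensorProduct.map LinearMap.id (antipode k)) U) *
          (LinearMap.mul' k H ((TensorProduct.map (antipode k) LinearMap.id) T) * w)) := by
          intro T U
          induction T with
          | zero => simp
          | add a b ha hb => simp only [TensorProduct.tmul_add, map_add, mul_add, add_mul, ha, hb]
          | tmul a b =>
            induction U with
            | zero => simp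
            | add a b ha hb => simp only [TensorProduct.add_tmul, map_add, mul_add, add_mul, ha, hb]
            | tmul c d => simp [hm, antipode_mul_antidistrib, mul_assoc]
        simp only [TensorProduct.map_tmul, LinearMap.id_apply, g, aux_S_id, aux_id_S,
          TensorProduct.rid_tmul, TensorProduct.lid_tmul]
        simp only [Algebra.algebraMap_eq_smul_one, smul_mul_assoc, mul_smul_comm, one_mul, mul_one,
          smul_smul]
        rw [mul_comm]
  rw [← e1, ← key, e2, hcu₂, hcu', one_mul]

set_option synthInstance.maxHeartbeats 400000 in
set_option maxHeartbeats 2000000 in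
lemma aux_main (F : H ⊗[k] H)
    (hcu₁ : (TensorProduct.lid k H)
      ((TensorProduct.map (Coalgebra.counit (R := k)) LinearMap.id) F) = 1)
    (hcoc : ((1 : H) ⊗ₜ[k] F) *
        (TensorProduct.map LinearMap.id (Coalgebra.comul (R := k)) F) =
      (TensorProduct.assoc k H H H)
        ((F ⊗ₜ[k] (1 : H)) *
          (TensorProduct.map (Coalgebra.comul (R := k)) LinearMap.id F)))
    (u : H) (hu : u = LinearMap.mul' k H ((TensorProduct.map LinearMap.id (antipode k)) F)) :
    F * comul (R := k) u * TensorProduct.map (antipode k) (antipode k)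
      (TensorProduct.comm k H H F) = u ⊗ₜ u := by
  let A : (H ⊗[k] H) ⊗[k] H →ₐ[k] H ⊗[k] (H ⊗[k] H) :=
    (Algebra.TensorProduct.assoc k k k H H H).toAlgHom
  have ma4 : ∀ a b c : H ⊗[k] (H ⊗[k] (H ⊗[k] H)), a * (b + c) = a * b + a * c :=
    fun a b c => (Algebra.TensorProduct.instRing : Ring (H ⊗[k] (H ⊗[k] (H ⊗[k] H)))).left_distrib a b c
  have am4 : ∀ a b c : H ⊗[k] (H ⊗[k] (H ⊗[k] H)), (a + b) * c = a * c + b * c :=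
    fun a b c => (Algebra.TensorProduct.instRing : Ring (H ⊗[k] (H ⊗[k] (H ⊗[k] H)))).right_distrib a b c
  have mz4 : ∀ a : H ⊗[k] (H ⊗[k] (H ⊗[k] H)), a * 0 = 0 := fun a => mul_zero a
  have zm4 : ∀ a : H ⊗[k] (H ⊗[k] (H ⊗[k] H)), 0 * a = 0 := fun a => zero_mul a
  have as4 : ∀ a b c : H ⊗[k] (H ⊗[k] (H ⊗[k] H)), a * b * c = a * (b * c) :=
    fun a b c => mul_assoc a b c
  have hA : ∀ x, TensorProduct.assoc k H H H x = A x := fun x => rfl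
  let D1 : H ⊗[k] H →ₐ[k] (H ⊗[k] H) ⊗[k] H :=
    Algebra.TensorProduct.map (Bialgebra.comulAlgHom k H) (AlgHom.id k H)
  let D2 : H ⊗[k] H →ₐ[k] H ⊗[k] (H ⊗[k] H) :=
    Algebra.TensorProduct.map (AlgHom.id k H) (Bialgebra.comulAlgHom k H)
  let E : H ⊗[k] (H ⊗[k] H) →ₐ[k] H ⊗[k] (H ⊗[k] (H ⊗[k] H)) :=
    Algebra.TensorProduct.map (AlgHom.id k H) D2
  have hc : ((1 : H) ⊗ₜ[k] F) * D2 F = A (F ⊗ₜ[k] (1 : H)) * A (D1 F) := by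
    rw [← map_mul]; exact hcoc
  have hE : ((1 : H) ⊗ₜ[k] (A (F ⊗ₜ[k] (1 : H)) * A (D1 F))) * E (D2 F) =
      ((1 : H) ⊗ₜ[k] ((1 : H) ⊗ₜ[k] F)) * (E (A (F ⊗ₜ[k] (1 : H))) * E (A (D1 F))) := by
    rw [← map_mul E, ← hc, map_mul, ← as4]
    congr 1
    simp [E]
  -- the contraction `a ⊗ b ⊗ c ⊗ d ↦ a S(d) ⊗ b S(c)`
  let m : H ⊗[k] (H ⊗[k] (H ⊗[k] H)) →ₗ[k] H ⊗[k] H :=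
    LinearMap.mul' k (H ⊗[k] H) ∘ₗ TensorProduct.map LinearMap.id
      (TensorProduct.map (antipode k) (antipode k) ∘ₗ (TensorProduct.comm k H H).toLinearMap) ∘ₗ
      (TensorProduct.assoc k H H (H ⊗[k] H)).symm.toLinearMap
  have hm : ∀ a b c d : H, m (a ⊗ₜ (b ⊗ₜ (c ⊗ₜ d))) =
      (a * antipode k d) ⊗ₜ (b * antipode k c) := fun a b c d => by simp [m]
  have r : ∀ Z Z' X : H ⊗[k] H,
      m (((1 : H) ⊗ₜ[k] ((1 : H) ⊗ₜ[k] Z)) * (E (A (Z' ⊗ₜ[k] (1 : H))) * E (A (D1 X)))) =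
      Z' * comul (R := k) (LinearMap.mul' k H ((TensorProduct.map LinearMap.id (antipode k)) X)) *
      TensorProduct.map (antipode k) (antipode k) (TensorProduct.comm k H H Z) := by
    intro Z Z' X
    induction X with
    | zero => simp [mz4, zm4]
    | add a b ha hb => simp only [map_add, mul_add, ma4, am4, add_mul, ha, hb]
    | tmul x y =>
      have q : D1 (x ⊗ₜ y) = comul (R := k) x ⊗ₜ y := rfl
      rw [q, TensorProduct.map_tmul, LinearMap.mul'_apply, LinearMap.id_apply, Bialgebra.comul_mul,
        aux_comul_antipode]
      generalize comul (R := k) x = T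
      have q2 : ∀ a b c : H, E (A ((a ⊗ₜ b) ⊗ₜ c)) = a ⊗ₜ (b ⊗ₜ comul (R := k) c) :=
        fun a b c => rfl
      induction T with
      | zero => simp [mz4, zm4]
      | add a b ha hb => simp only [TensorProduct.add_tmul, map_add, mul_add, ma4, am4, add_mul, ha, hb]
      | tmul a b =>
        induction Z' with
        | zero => simp [mz4, zm4]
        | add a b ha hb => simp only [TensorProduct.add_tmul, map_add, mul_add, ma4, am4, add_mul, ha, hb]
        | tmul c d =>
          rw [q2, q2]
          generalize comul (R := k) y = W
          simp only [Bialgebra.comul_one, Algebra.TensorProduct.tmul_mul_tmul, one_mul]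
          induction W with
          | zero => simp [mz4, zm4]
          | add a b ha hb => simp only [TensorProduct.tmul_add, ma4, am4, map_add, mul_add, ma4, am4, add_mul, ha, hb]
          | tmul e f =>
            induction Z with
            | zero => simp [mz4, zm4]
            | add a b ha hb => simp only [TensorProduct.tmul_add, ma4, am4, map_add, mul_add, ma4, am4, add_mul, ha, hb]
            | tmul g h => simp [hm, antipode_mul_antidistrib, mul_assoc]
  have l : ∀ Z Y X : H ⊗[k] H,
      m (((1 : H) ⊗ₜ[k] (A (Z ⊗ₜ[k] (1 : H)) * A (D1 Y))) * E (D2 X)) =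
      (LinearMap.mul' k H ((TensorProduct.map LinearMap.id (antipode k)) X) *
        antipode k ((TensorProduct.lid k H)
        ((TensorProduct.map (Coalgebra.counit (R := k)) LinearMap.id) Y))) ⊗ₜ
      (LinearMap.mul' k H ((TensorProduct.map LinearMap.id (antipode k)) Z)) := by
    intro Z Y X
    induction X with
    | zero => simp [mz4, zm4]
    | add a b ha hb => simp only [map_add, mul_add, ma4, am4, add_mul, ha, hb, TensorProduct.add_tmul]
    | tmul x x' =>
    induction Y with
    | zero => simp [mz4, zm4]
    | add a b ha hb =>
      simp only [map_add, mul_add, ma4, am4, add_mul, ha, hb, TensorProduct.add_tmul, TensorProduct.tmul_add]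
    | tmul y y' =>
    have q1 : D1 (y ⊗ₜ y') = comul (R := k) y ⊗ₜ y' := rfl
    have q2 : E (D2 (x ⊗ₜ x')) = x ⊗ₜ TensorProduct.assoc k H H H
        (TensorProduct.map (comul (R := k)) LinearMap.id (comul (R := k) x')) := by
      have e : E (D2 (x ⊗ₜ x')) = x ⊗ₜ
        (TensorProduct.map LinearMap.id (comul (R := k)) (comul (R := k) x')) := rfl
      rw [e]
      exact congrArg _ (Coalgebra.coassoc_apply (R := k) x').symm
    have g1 : ∀ (T W : H ⊗[k] H) (s : H),
      m (((1 : H) ⊗ₜ[k] (A (Z ⊗ₜ[k] (1 : H)) * A (T ⊗ₜ[k] y'))) * (x ⊗ₜ A (W ⊗ₜ s))) =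
      (x * (antipode k s * antipode k y')) ⊗ₜ
        (LinearMap.mul' k H (TensorProduct.map LinearMap.id (antipode k)
          (Z * T * W))) := by
      intro T W s
      rw [Algebra.TensorProduct.tmul_mul_tmul, ← map_mul A, ← map_mul A,
        Algebra.TensorProduct.tmul_mul_tmul, Algebra.TensorProduct.tmul_mul_tmul]
      generalize Z * T * W = V
      induction V with
      | zero => simp [mz4, zm4]
      | add a b ha hb => simp only [TensorProduct.add_tmul, TensorProduct.tmul_add, ma4, am4, map_add, ha, hb]
      | tmul a b =>
        have q : A ((a ⊗ₜ b) ⊗ₜ (1 * y' * s)) = a ⊗ₜ (b ⊗ₜ (1 * y' * s)) := rfl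
        rw [q, hm]
        simp [antipode_mul_antidistrib]
    have g2 : ∀ (V : H ⊗[k] H) (s : H),
      LinearMap.mul' k H (TensorProduct.map LinearMap.id (antipode k) (V * comul (R := k) s)) =
      counit (R := k) s • LinearMap.mul' k H (TensorProduct.map LinearMap.id (antipode k) V) := by
      intro V s
      induction V with
      | zero => simp [mz4, zm4]
      | add a b ha hb => simp only [map_add, add_mul, smul_add, ma4, am4, ha, hb]
      | tmul a b =>
        have g3 : ∀ W : H ⊗[k] H,
          LinearMap.mul' k H (TensorProduct.map LinearMap.id (antipode k) ((a ⊗ₜ b) * W)) =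
          a * LinearMap.mul' k H (TensorProduct.map LinearMap.id (antipode k) W) *
            antipode k b := by
          intro W
          induction W with
          | zero => simp [mz4, zm4]
          | add a b ha hb => simp only [map_add, add_mul, mul_add, ma4, am4, ha, hb]
          | tmul c d => simp [antipode_mul_antidistrib, mul_assoc]
        rw [g3, aux_id_S]
        simp [Algebra.algebraMap_eq_smul_one]
    rw [q1, q2]
    have g4 : ∀ R : H ⊗[k] H,
      m (((1 : H) ⊗ₜ[k] (A (Z ⊗ₜ[k] (1 : H)) * A (comul (R := k) y ⊗ₜ[k] y'))) *
        (x ⊗ₜ TensorProduct.assoc k H H H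
          (TensorProduct.map (comul (R := k)) LinearMap.id R))) =
      (x * (antipode k (TensorProduct.lid k H
        (TensorProduct.map (counit (R := k)) LinearMap.id R)) * antipode k y')) ⊗ₜ
        (counit (R := k) y • LinearMap.mul' k H (TensorProduct.map LinearMap.id (antipode k) Z)) := by
      intro R
      induction R with
      | zero => simp [mz4, zm4]
      | add a b ha hb =>
        simp only [map_add, add_mul, mul_add, ma4, am4, ha, hb, TensorProduct.add_tmul,
          TensorProduct.tmul_add]
      | tmul c d =>
        rw [TensorProduct.map_tmul, TensorProduct.map_tmul, LinearMap.id_apply, hA, g1, g2, g2,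
          TensorProduct.lid_tmul, map_smul, smul_mul_assoc, mul_smul_comm, TensorProduct.smul_tmul]
    rw [g4]
    have h4 : TensorProduct.map (counit (R := k)) LinearMap.id (comul (R := k) x') = 1 ⊗ₜ[k] x' :=
      Coalgebra.rTensor_counit_comul (R := k) x'
    rw [h4]
    simp [TensorProduct.smul_tmul, mul_assoc]
  have := r F F F
  rw [← hE, l, hcu₁, antipode_one, mul_one, ← hu] at this
  exact this.symm

end Aux

section Aux2
open Coalgebra HopfAlgebra

lemma aux_step {k H A : Type} [Field k] [Ring H] [HopfAlgebra k H] [Ring A] [Algebra k A]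
    (D : H →ₐ[k] A) (T : A →ₐ[k] A) (S2 : H →ₐ[k] H)
    (hT : ∀ h, T (D h) = D (S2 h)) (F : H ⊗[k] H) (Q : H) (Fn Qn : A)
    (h2 : F * comul (R := k) Q = (Q ⊗ₜ Q) * TensorProduct.map S2.toLinearMap S2.toLinearMap F)
    (hn : Fn * D Q = Qn * T Fn) :
    (((1 : H) ⊗ₜ[k] Fn) * TensorProduct.map LinearMap.id D.toLinearMap F) *
      TensorProduct.map LinearMap.id D.toLinearMap (comul (R := k) Q) =
    (Q ⊗ₜ[k] Qn) * TensorProduct.map S2.toLinearMap T.toLinearMap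
      (((1 : H) ⊗ₜ[k] Fn) * TensorProduct.map LinearMap.id D.toLinearMap F) := by
  let D' : H ⊗[k] H →ₐ[k] H ⊗[k] A := Algebra.TensorProduct.map (AlgHom.id k H) D
  let T' : H ⊗[k] A →ₐ[k] H ⊗[k] A := Algebra.TensorProduct.map S2 T
  let S' : H ⊗[k] H →ₐ[k] H ⊗[k] H := Algebra.TensorProduct.map S2 S2
  change ((1 : H) ⊗ₜ[k] Fn) * D' F * D' (comul Q) = (Q ⊗ₜ[k] Qn) * T' (((1 : H) ⊗ₜ[k] Fn) * D' F)
  have h2' : F * comul (R := k) Q = (Q ⊗ₜ Q) * S' F := h2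
  have hc : ∀ X, T' (D' X) = D' (S' X) := by
    intro X
    have : T'.comp D' = D'.comp S' := by
      ext x
      · simp [T', D', S']
      · simp [T', D', S', hT]
    exact congr($this X)
  have a1 : D' (Q ⊗ₜ Q) = Q ⊗ₜ D Q := rfl
  have a2 : T' ((1 : H) ⊗ₜ[k] Fn) = S2 1 ⊗ₜ T Fn := rfl
  rw [mul_assoc, ← map_mul, h2', map_mul, map_mul, hc, a1, a2, ← mul_assoc, ← mul_assoc,
    Algebra.TensorProduct.tmul_mul_tmul, Algebra.TensorProduct.tmul_mul_tmul, hn, map_one,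
    one_mul, mul_one]

variable (k H : Type) [Field k] [Ring H] [HopfAlgebra k H]

/-- The square of the antipode as an algebra map. -/
noncomputable def auxS2 : H →ₐ[k] H :=
  AlgHom.ofLinearMap (antipode k ∘ₗ antipode k) (by simp)
    (by intro x y; simp [antipode_mul_antidistrib])

lemma auxS2_comul (h : H) : comul (R := k) (auxS2 k H h) =
    TensorProduct.map (auxS2 k H).toLinearMap (auxS2 k H).toLinearMap (comul (R := k) h) := by
  change comul (R := k) (antipode k (antipode k h)) = _
  rw [aux_comul_antipode, aux_comul_antipode]
  generalize comul (R := k) h = T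
  induction T with
  | zero => simp
  | add a b ha hb => simp only [map_add, ha, hb]
  | tmul a b => rfl

/-- The iterated comultiplication as an algebra map. -/
noncomputable def auxD : ∀ n : ℕ, H →ₐ[k] Tpow k H n
  | 0 => AlgHom.id k H
  | n + 1 =>
      show H →ₐ[k] TensorProduct k H (Tpow k H n) from
        (Algebra.TensorProduct.map (AlgHom.id k H) (auxD n)).comp (Bialgebra.comulAlgHom k H)

/-- Tensor powers of `S²` as algebra maps. -/
noncomputable def auxT : ∀ n : ℕ, Tpow k H n →ₐ[k] Tpow k H n
  | 0 => auxS2 k H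
  | n + 1 =>
      show TensorProduct k H (Tpow k H n) →ₐ[k] TensorProduct k H (Tpow k H n) from
        Algebra.TensorProduct.map (auxS2 k H) (auxT n)

lemma auxD_eq (n : ℕ) : (auxD k H n).toLinearMap = comulIter k H n := by
  induction n with
  | zero => rfl
  | succ n ih =>
    change (TensorProduct.map LinearMap.id (auxD k H n).toLinearMap) ∘ₗ comul =
      (TensorProduct.map LinearMap.id (comulIter k H n)) ∘ₗ comul
    rw [ih]

lemma auxT_eq (n : ℕ) : (auxT k H n).toLinearMap = tmapPow k H (antipode k ∘ₗ antipode k) n := by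
  induction n with
  | zero => rfl
  | succ n ih =>
    change TensorProduct.map (antipode k ∘ₗ antipode k) (auxT k H n).toLinearMap =
      TensorProduct.map (antipode k ∘ₗ antipode k) (tmapPow k H (antipode k ∘ₗ antipode k) n)
    rw [ih]

lemma auxT_D (n : ℕ) (h : H) : auxT k H n (auxD k H n h) = auxD k H n (auxS2 k H h) := by
  induction n generalizing h with
  | zero => rfl
  | succ n ih =>
    change TensorProduct.map (auxS2 k H).toLinearMap (auxT k H n).toLinearMap
      (TensorProduct.map LinearMap.id (auxD k H n).toLinearMap (comul (R := k) h)) =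
      TensorProduct.map LinearMap.id (auxD k H n).toLinearMap (comul (R := k) (auxS2 k H h))
    rw [auxS2_comul]
    generalize comul (R := k) h = T
    induction T with
    | zero => simp only [map_zero]
    | add a b ha hb => simp only [map_add, ha, hb]
    | tmul a b =>
      simp only [TensorProduct.map_tmul, LinearMap.id_apply, AlgHom.toLinearMap_apply, ih]

lemma aux_all (F : H ⊗[k] H) (Q : H)
    (h2 : F * comul (R := k) Q = (Q ⊗ₜ Q) *
      TensorProduct.map (antipode k ∘ₗ antipode k) (antipode k ∘ₗ antipode k) F) (n : ℕ) :
    Fseq k H F n * auxD k H n Q = nest k H n (fun _ => Q) * auxT k H n (Fseq k H F n) := by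
  induction n with
  | zero =>
    change (1 : H) * Q = Q * auxS2 k H 1
    rw [map_one, mul_one, one_mul]
  | succ n ih =>
    have := aux_step (auxD k H n) (auxT k H n) (auxS2 k H) (auxT_D k H n) F Q (Fseq k H F n)
      (nest k H n (fun _ => Q)) h2 ih
    rw [auxD_eq] at this
    have e : auxD k H (n+1) Q = TensorProduct.map LinearMap.id (comulIter k H n)
      (comul (R := k) Q) := by rw [← auxD_eq]; rfl
    rw [e]
    exact this

lemma aux_Q [FiniteDimensional k H] (F F' : H ⊗[k] H)
    (hinv₁ : F * F' = 1) (hinv₂ : F' * F = 1)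
    (u v : H) (huv : u * v = 1) (hvu : v * u = 1)
    (hm : F * comul (R := k) u * TensorProduct.map (antipode k) (antipode k)
      (TensorProduct.comm k H H F) = u ⊗ₜ u) (Q : H) (hQ : Q = u * antipode k v) :
    F * comul (R := k) Q = (Q ⊗ₜ Q) *
      TensorProduct.map (antipode k ∘ₗ antipode k) (antipode k ∘ₗ antipode k) F := by
  let σ : H ⊗[k] H →ₗ[k] H ⊗[k] H := TensorProduct.map (antipode k) (antipode k) ∘ₗ
      (TensorProduct.comm k H H).toLinearMap
  have hσ : ∀ X Y, σ (X * Y) = σ Y * σ X := by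
    intro X Y
    induction X with
    | zero => simp
    | add a b ha hb => simp only [map_add, add_mul, mul_add, ha, hb]
    | tmul a b =>
      induction Y with
      | zero => simp
      | add a b ha hb => simp only [map_add, add_mul, mul_add, ha, hb]
      | tmul c d => simp [σ, antipode_mul_antidistrib]
  have hσ2 : ∀ X, σ (σ X) =
      TensorProduct.map (antipode k ∘ₗ antipode k) (antipode k ∘ₗ antipode k) X := by
    intro X
    induction X with
    | zero => simp
    | add a b ha hb => simp only [map_add, ha, hb]
    | tmul a b => simp [σ]
  have hΔ : ∀ x, comul (R := k) (antipode k x) = σ (comul (R := k) x) := aux_comul_antipode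
  have hσ1 : σ 1 = 1 := by
    rw [Algebra.TensorProduct.one_def]; simp [σ]
  rw [← hσ2]
  have hm' : F * comul (R := k) u * σ F = u ⊗ₜ u := hm
  have i1 : σ F * σ F' = 1 := by rw [← hσ, hinv₂, hσ1]
  have huu : (u ⊗ₜ[k] u) * (v ⊗ₜ[k] v) = 1 := by
    rw [Algebra.TensorProduct.tmul_mul_tmul, huv]; rfl
  -- F Δ(u) = (u⊗u) σ(F')
  have j1 : F * comul (R := k) u = (u ⊗ₜ u) * σ F' := by
    rw [← hm', mul_assoc, i1, mul_one]
  -- Δ(v) = σ(F) (v⊗v) F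
  have hvv : comul (R := k) v * comul (R := k) u = 1 := by
    rw [← Bialgebra.comul_mul, hvu, Bialgebra.comul_one]
  have j2 : comul (R := k) v = σ F * (v ⊗ₜ v) * F := by
    have w : comul (R := k) u * (σ F * (v ⊗ₜ v) * F) = 1 := by
      calc comul (R := k) u * (σ F * (v ⊗ₜ v) * F)
          = (F' * F) * comul (R := k) u * (σ F * (v ⊗ₜ v) * F) := by rw [hinv₂, one_mul]
        _ = F' * ((F * comul (R := k) u * σ F) * (v ⊗ₜ v)) * F := by simp only [mul_assoc]
        _ = 1 := by rw [hm', huu, mul_one, hinv₂]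
    exact left_inv_eq_right_inv hvv w
  have hi : σ F' * σ (σ F * (v ⊗ₜ v) * F) = σ (v ⊗ₜ v) * σ (σ F) := by
    have : σ F' * σ F = 1 := by rw [← hσ, hinv₁, hσ1]
    rw [hσ, hσ, ← mul_assoc, this, one_mul]
  have hv : σ (v ⊗ₜ v) = antipode k v ⊗ₜ antipode k v := by simp [σ]
  rw [hQ, Bialgebra.comul_mul, ← mul_assoc, j1, hΔ, j2, mul_assoc, hi, hv, ← mul_assoc,
    Algebra.TensorProduct.tmul_mul_tmul]

end Aux2

theorem statement10
    (k H : Type) [Field k] [Ring H] [HopfAlgebra k H] [FiniteDimensional k H]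
    (S : H →ₗ[k] H) (hS : S = HopfAlgebra.antipode (R := k))
    (F F' : H ⊗[k] H)
    (hinv₁ : F * F' = 1) (hinv₂ : F' * F = 1)
    (hcu₁ : (TensorProduct.lid k H)
      ((TensorProduct.map (Coalgebra.counit (R := k)) LinearMap.id) F) = 1)
    (hcu₂ : (TensorProduct.rid k H)
      ((TensorProduct.map LinearMap.id (Coalgebra.counit (R := k))) F) = 1)
    (hcoc : ((1 : H) ⊗ₜ[k] F) *
        (TensorProduct.map LinearMap.id (Coalgebra.comul (R := k)) F) =
      (TensorProduct.assoc k H H H)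
        ((F ⊗ₜ[k] (1 : H)) *
          (TensorProduct.map (Coalgebra.comul (R := k)) LinearMap.id F)))
    (u : H) (hu : u = LinearMap.mul' k H ((TensorProduct.map LinearMap.id S) F))
    (Q : H) (hQ : Q = u * S (Ring.inverse u))
    (n : ℕ) (hn : 1 ≤ n) :
    Fseq k H F (n - 1) * comulIter k H (n - 1) Q =
      nest k H (n - 1) (fun _ => Q) *
        tmapPow k H (S ∘ₗ S) (n - 1) (Fseq k H F (n - 1)) := by
  have huv := aux_inv S hS F F' hinv₁ hinv₂ hcu₁ hcu₂ hcoc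
  subst hS
  rw [← hu] at huv
  have hvu : LinearMap.mul' k H (TensorProduct.map (HopfAlgebra.antipode k) LinearMap.id F') * u
      = 1 := by
    have : IsNoetherian k H := inferInstance
    have : IsNoetherianRing H := isNoetherian_of_tower k this
    exact mul_eq_one_comm.mp huv
  generalize LinearMap.mul' k H (TensorProduct.map (HopfAlgebra.antipode k) LinearMap.id F') = v
    at huv hvu
  have hinv : Ring.inverse u = v := by
    have : Ring.inverse ((⟨u, v, huv, hvu⟩ : Hˣ) : H) = v := by rw [Ring.inverse_unit]; rfl
    exact this
  rw [hinv] at hQ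
  have h2 := aux_Q k H F F' hinv₁ hinv₂ u v huv hvu (aux_main F hcu₁ hcoc u hu) Q hQ
  have h3 := aux_all k H F Q h2 (n - 1)
  rw [← auxD_eq, ← auxT_eq]
  exact h3
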